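/- Let Q = [B | C] be an ice quiver with three mutable vertices whose mutable subquiver is a mutation-cyclic quiver on three vertices, and let v be any mutable vertex. Write [B^{[v]} | C^{[v]}] = μ_v([B | C]), and suppose: (1) every mutable vertex of μ_v(Q) is red or green; (2) if every entry of b^{[v]}_{vj}·c^{[v]}_j is ≥ 0 for some mutable j ≠ v, then sgn(c^{[v]}_j) = sgn(c^{[v]}_v) or sgn(c^{[v]}_j)·c^{[v]}_j ≥ sgn(c^{[v]}_v)·c^{[v]}_v entrywise; (3) if every entry of b^{[v]}_{vj}·c^{[v]}_j is ≤ 0 for some mutable j ≠ v, then sgn(c^{[v]}_j) = -sgn(c^{[v]}_v); (4) if every entry of b^{[v]}_{ij}·c^{[v]}_j is ≥ 0 for distinct mutable i, j both different from v, then sgn(c^{[v]}_i) = sgn(c^{[v]}_j). Then for every reduced mutation sequence w beginning with v, writing r for the last vertex of w and [B^w | C^w] = μ_w([B | C]): every mutable vertex of μ_w(Q) is red or green; if every entry of b^w_{rj}·c^w_j is ≥ 0 for some mutable j ≠ r, then sgn(c^w_j) = sgn(c^w_r) or sgn(c^w_j)·c^w_j ≥ sgn(c^w_r)·c^w_r entrywise;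 if every entry of b^w_{rj}·c^w_j is ≤ 0 for some mutable j ≠ r, then sgn(c^w_j) = -sgn(c^w_r); and if every entry of b^w_{ij}·c^w_j is ≥ 0 for distinct mutable i, j both different from r, then sgn(c^w_i) = sgn(c^w_j). -/

import Mathlib

open Matrix

section QuiverDefs

variable {V W : Type*}

/-- Mutation of an exchange matrix at the vertex `k`. -/
def mutB [DecidableEq V] (B : Matrix V V ℤ) (k : V) : Matrix V V ℤ :=
  Matrix.of fun i j =>
    if i = k ∨ j = k then -B i j else B i j + (B i k).sign * max (B i k * B k j) 0

/-- Mutation of the `C`-matrix of an extended exchange matrix `[B | C]` at the vertex `k`. -/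
def mutC [DecidableEq V] (B : Matrix V V ℤ) (C : Matrix V W ℤ) (k : V) : Matrix V W ℤ :=
  Matrix.of fun i j =>
    if i = k then -C i j else C i j + (B i k).sign * max (B i k * C k j) 0

/-- One mutation step on an extended exchange matrix `[B | C]`, regarded as a pair `(B, C)`. -/
def mutPair [DecidableEq V] (P : Matrix V V ℤ × Matrix V W ℤ) (k : V) :
    Matrix V V ℤ × Matrix V W ℤ :=
  (mutB P.1 k, mutC P.1 P.2 k)

/-- Iterated mutation of an extended exchange matrix along a list of mutable vertices. -/
def mutSeqPair [DecidableEq V] (P : Matrix V V ℤ × Matrix V W ℤ) (w : List V) :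
    Matrix V V ℤ × Matrix V W ℤ :=
  w.foldl mutPair P

/-- Iterated mutation of an exchange matrix along a list of vertices. -/
def mutSeqB [DecidableEq V] (B : Matrix V V ℤ) (w : List V) : Matrix V V ℤ :=
  w.foldl mutB B

/-- A quiver is abundant if there are at least two arrows between any two distinct vertices. -/
def QAbundant (B : Matrix V V ℤ) : Prop := ∀ i j, i ≠ j → 2 ≤ |B i j|

/-- There is a directed cycle of the quiver `B` all of whose vertices lie in `S`. -/
def HasCycleIn (B : Matrix V V ℤ) (S : Set V) : Prop :=
  ∃ (x : V) (l : List V), x ∈ S ∧ (∀ y ∈ l, y ∈ S) ∧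
    List.Chain (fun i j => 0 < B i j) x (l ++ [x])

/-- A quiver is acyclic if it has no directed cycle. -/
def QAcyclic (B : Matrix V V ℤ) : Prop := ¬ HasCycleIn B Set.univ

/-- The vertex `x` is a source: all arrows at `x` point away from `x`. -/
def QSource (B : Matrix V V ℤ) (x : V) : Prop := ∀ j, 0 ≤ B x j

/-- The vertex `x` is a sink: all arrows at `x` point into `x`. -/
def QSink (B : Matrix V V ℤ) (x : V) : Prop := ∀ j, B x j ≤ 0

/-- `B` is a fork with point of return `r`: it is abundant, not acyclic, the full subquiver
obtained by deleting `r` is acyclic, and for all `i` with `i → r` and `j` with `r → j` one has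
`b_{ji} > b_{ir}` and `b_{ji} > b_{rj}`. -/
def QFork (B : Matrix V V ℤ) (r : V) : Prop :=
  QAbundant B ∧ ¬ QAcyclic B ∧ ¬ HasCycleIn B {x | x ≠ r} ∧
    ∀ i j, 0 < B i r → 0 < B r j → B i r < B j i ∧ B r j < B j i

/-- The mutable vertex `i` is green: its `c`-vector is nonzero with all entries `≥ 0`. -/
def QGreen (C : Matrix V W ℤ) (i : V) : Prop := (∀ j, 0 ≤ C i j) ∧ C i ≠ 0

/-- The mutable vertex `i` is red: its `c`-vector is nonzero with all entries `≤ 0`. -/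
def QRed (C : Matrix V W ℤ) (i : V) : Prop := (∀ j, C i j ≤ 0) ∧ C i ≠ 0

/-- The mutable vertex `i` is blue: its `c`-vector is zero. -/
def QBlue (C : Matrix V W ℤ) (i : V) : Prop := C i = 0

/-- `i` has the same color (red/green/blue) with respect to `C` and to `C'`. -/
def SameColorQ (C C' : Matrix V W ℤ) (i : V) : Prop :=
  (QRed C i ↔ QRed C' i) ∧ (QGreen C i ↔ QGreen C' i) ∧ (QBlue C i ↔ QBlue C' i)

/-- The `c`-vectors of `i` and `j` have the same sign (`sgn(c_i) = sgn(c_j)`). -/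
def SameSignQ (C : Matrix V W ℤ) (i j : V) : Prop :=
  (QGreen C i ∧ QGreen C j) ∨ (QRed C i ∧ QRed C j)

/-- The `c`-vectors of `i` and `j` have opposite signs (`sgn(c_i) = -sgn(c_j)`). -/
def OppSignQ (C : Matrix V W ℤ) (i j : V) : Prop :=
  (QGreen C i ∧ QRed C j) ∨ (QRed C i ∧ QGreen C j)

/-- An ice quiver is uniformly sign-coherent if after every mutation sequence every mutable
vertex is red, green, or blue, and not every mutable vertex of the initial quiver is blue. -/
def USC [DecidableEq V] (P : Matrix V V ℤ × Matrix V W ℤ) : Prop :=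
  (∀ (w : List V) (i : V),
      QRed (mutSeqPair P w).2 i ∨ QGreen (mutSeqPair P w).2 i ∨ QBlue (mutSeqPair P w).2 i) ∧
    ¬ ∀ i, QBlue P.2 i

/-- An ice quiver is strictly sign-coherent if after every mutation sequence every mutable
vertex is red or green. -/
def SSC [DecidableEq V] (P : Matrix V V ℤ × Matrix V W ℤ) : Prop :=
  ∀ (w : List V) (i : V), QRed (mutSeqPair P w).2 i ∨ QGreen (mutSeqPair P w).2 i

/-- The four sign conditions at the distinguished vertex `r`:
(1) every mutable vertex is red or green;
(2) if every entry of `b_{rj}·c_j` is `≥ 0` for some `j ≠ r`, then `sgn(c_j) = sgn(c_r)` or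
    `sgn(c_j)·c_j ≥ sgn(c_r)·c_r` entrywise (i.e. `|c_r| ≤ |c_j|` entrywise);
(3) if every entry of `b_{rj}·c_j` is `≤ 0` for some `j ≠ r`, then `sgn(c_j) = -sgn(c_r)`;
(4) if every entry of `b_{ij}·c_j` is `≥ 0` for distinct `i, j` both `≠ r`,
    then `sgn(c_i) = sgn(c_j)`. -/
def FourConds (Bw : Matrix V V ℤ) (Cw : Matrix V W ℤ) (r : V) : Prop :=
  (∀ i, QRed Cw i ∨ QGreen Cw i) ∧
  (∀ j, j ≠ r → (∀ t, 0 ≤ Bw r j * Cw j t) →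
    (SameSignQ Cw j r ∨ ∀ t, |Cw r t| ≤ |Cw j t|)) ∧
  (∀ j, j ≠ r → (∀ t, Bw r j * Cw j t ≤ 0) → OppSignQ Cw j r) ∧
  (∀ i j, i ≠ j → i ≠ r → j ≠ r → (∀ t, 0 ≤ Bw i j * Cw j t) → SameSignQ Cw i j)

end QuiverDefs

/-- Any walk of length three in a skew-symmetric three-vertex quiver comes from a 3-cycle. -/
def CycThree (B : Matrix (Fin 3) (Fin 3) ℤ) : Prop :=
  ∀ i j k : Fin 3, i ≠ j → j ≠ k → k ≠ i →
    (0 < B i j ∧ 0 < B j k ∧ 0 < B k i) ∨ (B i j < 0 ∧ B j k < 0 ∧ B k i < 0)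

lemma third_vertex (i j k : Fin 3) (h1 : i ≠ j) (h2 : j ≠ k) (h3 : k ≠ i) (x : Fin 3) :
    x = i ∨ x = j ∨ x = k := by
  revert i j k x; decide

lemma exists_others (r : Fin 3) : ∃ i j : Fin 3, r ≠ i ∧ i ≠ j ∧ j ≠ r := by
  revert r; decide

lemma cyc_of_not_acyclic (B : Matrix (Fin 3) (Fin 3) ℤ) (hs : ∀ i j, B j i = -B i j)
    (h : ¬ QAcyclic B) : CycThree B := by
  unfold QAcyclic at h
  rw [not_not] at h
  obtain ⟨x, l, -, -, hc0⟩ := h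
  have hc : List.IsChain (fun i j => 0 < B i j) (x :: (l ++ [x])) := hc0
  have h3 : ∃ a b c d : Fin 3, 0 < B a b ∧ 0 < B b c ∧ 0 < B c d := by
    rcases l with _ | ⟨a, _ | ⟨b, l⟩⟩
    · simp [List.isChain_cons_cons] at hc
      have := hs x x
      omega
    · simp [List.isChain_cons_cons] at hc
      have := hs x a
      omega
    · rcases l with _ | ⟨c, l⟩
      · simp [List.isChain_cons_cons] at hc
        exact ⟨x, a, b, x, hc⟩
      · simp [List.isChain_cons_cons] at hc
        exact ⟨x, a, b, c, hc.1, hc.2.1, hc.2.2.1⟩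
  obtain ⟨a, b, c, d, hab, hbc, hcd⟩ := h3
  have nab : a ≠ b := by rintro rfl; have := hs a a; omega
  have nbc : b ≠ c := by rintro rfl; have := hs b b; omega
  have ncd : c ≠ d := by rintro rfl; have := hs c c; omega
  have nac : c ≠ a := by rintro rfl; have := hs c b; omega
  have nbd : b ≠ d := by rintro rfl; have := hs b c; omega
  have hda : d = a := by
    rcases third_vertex a b c nab nbc nac d with h | h | h
    · exact h
    · exact absurd h.symm nbd
    · exact absurd h.symm ncd
  subst hda
  have e1 := hs d b
  have e2 := hs b c
  have e3 := hs c d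
  intro i j k h1 h2 h3
  rcases third_vertex d b c nab nbc nac i with rfl | rfl | rfl <;>
  rcases third_vertex _ _ _ nab nbc nac j with rfl | rfl | rfl <;>
  rcases third_vertex _ _ _ nab nbc nac k with rfl | rfl | rfl <;>
  first
  | exact absurd rfl h1
  | exact absurd rfl h2
  | exact absurd rfl h3
  | omega

lemma mutB_skew (B : Matrix (Fin 3) (Fin 3) ℤ) (hs : ∀ i j, B j i = -B i j) (k : Fin 3) :
    ∀ i j, mutB B k j i = -mutB B k i j := by
  intro i j
  by_cases hi : i = k
  · simp [mutB, hi, hs k j]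
  by_cases hj : j = k
  · simp [mutB, hj, hs k i]
  simp only [mutB, Matrix.of_apply, hi, hj, or_self, if_false]
  rw [hs i j, hs k j, hs i k]
  rcases lt_trichotomy (B i k) 0 with h | h | h <;>
  rcases lt_trichotomy (B k j) 0 with h' | h' | h' <;>
  first
  | (simp [h, h']; done)
  | skip
  · rw [Int.sign_eq_one_of_pos (show 0 < -B k j by omega), Int.sign_eq_neg_one_of_neg h]
    have : -B k j * -B i k = B i k * B k j := by ring
    rw [this]; ring
  · rw [max_eq_right (by nlinarith), max_eq_right (by nlinarith)]; ring
  · rw [max_eq_right (by nlinarith), max_eq_right (by nlinarith)]; ring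
  · rw [Int.sign_eq_neg_one_of_neg (show -B k j < 0 by omega), Int.sign_eq_one_of_pos h]
    have : -B k j * -B i k = B i k * B k j := by ring
    rw [this]; ring

lemma mutB_neg (B : Matrix (Fin 3) (Fin 3) ℤ) (k : Fin 3) : mutB (-B) k = -mutB B k := by
  ext i j
  simp only [mutB, Matrix.of_apply, Matrix.neg_apply, neg_mul_neg, Int.sign_neg]
  split_ifs <;> ring

lemma mutC_neg {m : ℕ} (B : Matrix (Fin 3) (Fin 3) ℤ) (C : Matrix (Fin 3) (Fin m) ℤ)
    (k : Fin 3) : mutC (-B) (-C) k = -mutC B C k := by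
  ext i j
  simp only [mutC, Matrix.of_apply, Matrix.neg_apply, neg_mul_neg, Int.sign_neg]
  split_ifs <;> ring

lemma CycThree.neg {B : Matrix (Fin 3) (Fin 3) ℤ} (h : CycThree B) : CycThree (-B) := by
  intro i j k h1 h2 h3
  simp only [Matrix.neg_apply]
  rcases h i j k h1 h2 h3 with h | h <;> omega

lemma mutB_pos (B : Matrix (Fin 3) (Fin 3) ℤ) (k i j : Fin 3) (hi : i ≠ k) (hj : j ≠ k)
    (h1 : 0 < B i k) (h2 : 0 < B k j) : mutB B k i j = B i j + B i k * B k j := by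
  simp only [mutB, Matrix.of_apply, hi, hj, or_self, if_false]
  rw [Int.sign_eq_one_of_pos h1, max_eq_left (by positivity)]; ring

lemma mutB_left (B : Matrix (Fin 3) (Fin 3) ℤ) (k j : Fin 3) : mutB B k k j = -B k j := by
  simp [mutB]

lemma mutB_right (B : Matrix (Fin 3) (Fin 3) ℤ) (k j : Fin 3) : mutB B k j k = -B j k := by
  simp [mutB]

/-- Weights of positive edges are at least two. -/
lemma two_le (B : Matrix (Fin 3) (Fin 3) ℤ) (hs : ∀ i j, B j i = -B i j) (hB : CycThree B)
    (hm : ∀ k, CycThree (mutB B k)) (i j k : Fin 3) (h1 : i ≠ j) (h2 : j ≠ k) (h3 : k ≠ i)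
    (hp : 0 < B i j) : 2 ≤ B i j := by
  by_contra hlt
  have e : B i j = 1 := by omega
  have hjk : 0 < B j k ∧ 0 < B k i := by
    rcases hB i j k h1 h2 h3 with h | h <;> omega
  have a1 := hm i i j k h1 h2 h3
  have a2 := hm j i j k h1 h2 h3
  have s1 := mutB_skew B hs i k j
  have b1 := mutB_pos B i k j h3 h1.symm hjk.2 hp
  have b2 := mutB_pos B j i k h1 h2.symm hp hjk.1
  have s2 := mutB_skew B hs j i k
  rw [mutB_left] at a1
  rw [mutB_right] at a1
  rw [mutB_right, mutB_left] at a2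
  rw [e] at b1 b2
  have t1 := hs j k
  have t2 := hs k i
  omega

/-- The inductive invariant, in the case when the last mutated vertex is red. -/
def GoodOne {m : ℕ} (B : Matrix (Fin 3) (Fin 3) ℤ) (C : Matrix (Fin 3) (Fin m) ℤ)
    (r : Fin 3) : Prop :=
  ∃ i j : Fin 3, r ≠ i ∧ i ≠ j ∧ j ≠ r ∧ 0 < B r i ∧ 0 < B i j ∧ 0 < B j r ∧
    QRed C r ∧ (∀ t, 0 ≤ C i t + C r t) ∧ (QRed C j ∨ QGreen C j)

def GoodInv {m : ℕ} (B : Matrix (Fin 3) (Fin 3) ℤ) (C : Matrix (Fin 3) (Fin m) ℤ)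
    (r : Fin 3) : Prop := GoodOne B C r ∨ GoodOne (-B) (-C) r

lemma red_neg {m : ℕ} (C : Matrix (Fin 3) (Fin m) ℤ) (i : Fin 3) :
    QRed (-C) i ↔ QGreen C i := by
  have : (-C) i = -(C i) := rfl
  simp [QRed, QGreen, this]

lemma green_neg {m : ℕ} (C : Matrix (Fin 3) (Fin m) ℤ) (i : Fin 3) :
    QGreen (-C) i ↔ QRed C i := by
  have : (-C) i = -(C i) := rfl
  simp [QRed, QGreen, this]

lemma not_red_green {m : ℕ} {C : Matrix (Fin 3) (Fin m) ℤ} {i : Fin 3}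
    (h1 : QRed C i) (h2 : QGreen C i) : False :=
  h1.2 (funext fun t => le_antisymm (h1.1 t) (h2.1 t))

lemma green_of_dom {m : ℕ} {C : Matrix (Fin 3) (Fin m) ℤ} {i r : Fin 3}
    (h1 : QRed C r) (h2 : ∀ t, 0 ≤ C i t + C r t) : QGreen C i := by
  refine ⟨fun t => by have := h1.1 t; have := h2 t; omega, fun h0 => h1.2 ?_⟩
  funext t
  have a := h1.1 t
  have b := h2 t
  have c : C i t = 0 := by rw [h0]; rfl
  simp only [Pi.zero_apply]
  omega

lemma FourConds.neg {m : ℕ} {B : Matrix (Fin 3) (Fin 3) ℤ} {C : Matrix (Fin 3) (Fin m) ℤ}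
    {r : Fin 3} (h : FourConds (-B) (-C) r) : FourConds B C r := by
  simp only [FourConds, SameSignQ, OppSignQ, red_neg, green_neg, Matrix.neg_apply,
    neg_mul_neg, abs_neg] at h ⊢
  obtain ⟨h1, h2, h3, h4⟩ := h
  refine ⟨fun i => (h1 i).symm, fun j hj ht => ?_, fun j hj ht => (h3 j hj ht).symm,
    fun i j a b c d => (h4 i j a b c d).symm⟩
  have := h2 j hj ht
  tauto

lemma four_of_goodOne {m : ℕ} {B : Matrix (Fin 3) (Fin 3) ℤ} {C : Matrix (Fin 3) (Fin m) ℤ}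
    {r : Fin 3} (hs : ∀ i j, B j i = -B i j) (h : GoodOne B C r) : FourConds B C r := by
  obtain ⟨i, j, h1, h2, h3, bri, bij, bjr, hr, hi, hj⟩ := h
  have gi := green_of_dom hr hi
  -- extraction of colours
  have key1 : ∀ (b : ℤ) (x : Fin 3), 0 < b → (∀ t, 0 ≤ b * C x t) → ∀ t, 0 ≤ C x t :=
    fun b x hb h t => nonneg_of_mul_nonneg_right (h t) hb
  have key2 : ∀ (b : ℤ) (x : Fin 3), b < 0 → (∀ t, 0 ≤ b * C x t) → ∀ t, C x t ≤ 0 :=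
    fun b x hb h t => by have := h t; by_contra hc; push Not at hc; nlinarith
  have key3 : ∀ (b : ℤ) (x : Fin 3), 0 < b → (∀ t, b * C x t ≤ 0) → ∀ t, C x t ≤ 0 :=
    fun b x hb h t => by have := h t; by_contra hc; push Not at hc; nlinarith
  have key4 : ∀ (b : ℤ) (x : Fin 3), b < 0 → (∀ t, b * C x t ≤ 0) → ∀ t, 0 ≤ C x t :=
    fun b x hb h t => by have := h t; by_contra hc; push Not at hc; nlinarith
  have brj : B r j < 0 := by have := hs j r; omega
  have bji : B j i < 0 := by have := hs i j; omega
  have nzj : C j ≠ 0 := by rcases hj with h | h <;> exact h.2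
  refine ⟨fun x => ?_, fun x hx ht => ?_, fun x hx ht => ?_, fun x y hxy hx hy ht => ?_⟩
  · rcases third_vertex r i j h1 h2 h3 x with rfl | rfl | rfl
    · exact Or.inl hr
    · exact Or.inr gi
    · exact hj
  · rcases third_vertex r i j h1 h2 h3 x with rfl | rfl | rfl
    · exact absurd rfl hx
    · right
      intro t
      rw [abs_of_nonneg (gi.1 t), abs_of_nonpos (hr.1 t)]
      have := hi t
      omega
    · exact Or.inl (Or.inr ⟨⟨key2 _ _ brj ht, nzj⟩, hr⟩)
  · rcases third_vertex r i j h1 h2 h3 x with rfl | rfl | rfl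
    · exact absurd rfl hx
    · exact (not_red_green ⟨key3 _ _ bri ht, gi.2⟩ gi).elim
    · exact Or.inl ⟨⟨key4 _ _ brj ht, nzj⟩, hr⟩
  · rcases third_vertex r i j h1 h2 h3 x with rfl | rfl | rfl
    · exact absurd rfl hx
    · rcases third_vertex r x j h1 h2 h3 y with rfl | rfl | rfl
      · exact absurd rfl hy
      · exact absurd rfl hxy
      · exact Or.inl ⟨gi, ⟨key1 _ _ bij ht, nzj⟩⟩
    · rcases third_vertex r i x h1 h2 h3 y with rfl | rfl | rfl
      · exact absurd rfl hy
      · exact (not_red_green ⟨key2 _ _ bji ht, gi.2⟩ gi).elim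
      · exact absurd rfl hxy

lemma four_of_good {m : ℕ} {B : Matrix (Fin 3) (Fin 3) ℤ} {C : Matrix (Fin 3) (Fin m) ℤ}
    {r : Fin 3} (hs : ∀ i j, B j i = -B i j) (h : GoodInv B C r) : FourConds B C r := by
  rcases h with h | h
  · exact four_of_goodOne hs h
  · exact (four_of_goodOne (fun i j => by simp [hs i j]) h).neg

lemma goodOne_of_four {m : ℕ} {B : Matrix (Fin 3) (Fin 3) ℤ} {C : Matrix (Fin 3) (Fin m) ℤ}
    {r : Fin 3} (hs : ∀ i j, B j i = -B i j) (hB : CycThree B)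
    (h : FourConds B C r) (hr : QRed C r) : GoodOne B C r := by
  obtain ⟨i, j, h1, h2, h3, b1, b2, b3⟩ : ∃ i j : Fin 3, r ≠ i ∧ i ≠ j ∧ j ≠ r ∧
      0 < B r i ∧ 0 < B i j ∧ 0 < B j r := by
    obtain ⟨i, j, h1, h2, h3⟩ := exists_others r
    rcases hB r i j h1 h2 h3 with h | h
    · exact ⟨i, j, h1, h2, h3, h⟩
    · refine ⟨j, i, h3.symm, h2.symm, h1.symm, ?_⟩
      have := hs r i
      have := hs i j
      have := hs j r
      omega
  obtain ⟨c1, c2, c3, c4⟩ := h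
  refine ⟨i, j, h1, h2, h3, b1, b2, b3, hr, ?_, c1 j⟩
  have gi : QGreen C i := by
    rcases c1 i with hi | hi
    · rcases c3 i h1.symm (fun t => mul_nonpos_of_nonneg_of_nonpos b1.le (hi.1 t)) with h | h
      · exact h.1
      · exact h.2 |> fun g => (not_red_green hr g).elim
    · exact hi
  rcases c2 i h1.symm (fun t => mul_nonneg b1.le (gi.1 t)) with h | h
  · rcases h with h | h
    · exact (not_red_green hr h.2).elim
    · exact (not_red_green h.1 gi).elim
  · intro t
    have := h t
    rw [abs_of_nonneg (gi.1 t), abs_of_nonpos (hr.1 t)] at this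
    omega

lemma good_of_four {m : ℕ} {B : Matrix (Fin 3) (Fin 3) ℤ} {C : Matrix (Fin 3) (Fin m) ℤ}
    {r : Fin 3} (hs : ∀ i j, B j i = -B i j) (hB : CycThree B)
    (h : FourConds B C r) : GoodInv B C r := by
  rcases h.1 r with hr | hr
  · exact Or.inl (goodOne_of_four hs hB h hr)
  · right
    refine goodOne_of_four (fun i j => by simp [hs i j]) hB.neg ?_ ((red_neg C r).2 hr)
    apply FourConds.neg
    simpa using h

lemma mutC_self {m : ℕ} (B : Matrix (Fin 3) (Fin 3) ℤ) (C : Matrix (Fin 3) (Fin m) ℤ)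
    (k : Fin 3) (t : Fin m) : mutC B C k k t = -C k t := by
  simp [mutC]

lemma mutC_pos {m : ℕ} (B : Matrix (Fin 3) (Fin 3) ℤ) (C : Matrix (Fin 3) (Fin m) ℤ)
    (k i : Fin 3) (t : Fin m) (hi : i ≠ k) (hb : 0 < B i k) (hc : 0 ≤ C k t) :
    mutC B C k i t = C i t + B i k * C k t := by
  simp only [mutC, Matrix.of_apply, hi, if_false]
  rw [Int.sign_eq_one_of_pos hb, max_eq_left (by positivity)]; ring

lemma mutC_neg_neg {m : ℕ} (B : Matrix (Fin 3) (Fin 3) ℤ) (C : Matrix (Fin 3) (Fin m) ℤ)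
    (k i : Fin 3) (t : Fin m) (hi : i ≠ k) (hb : B i k < 0) (hc : C k t ≤ 0) :
    mutC B C k i t = C i t - B i k * C k t := by
  simp only [mutC, Matrix.of_apply, hi, if_false]
  rw [Int.sign_eq_neg_one_of_neg hb,
    max_eq_left (mul_nonneg_of_nonpos_of_nonpos hb.le hc)]; ring

lemma mutC_same {m : ℕ} (B : Matrix (Fin 3) (Fin 3) ℤ) (C : Matrix (Fin 3) (Fin m) ℤ)
    (k i : Fin 3) (t : Fin m) (hi : i ≠ k) (h : B i k * C k t ≤ 0) :
    mutC B C k i t = C i t := by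
  simp only [mutC, Matrix.of_apply, hi, if_false]
  rw [max_eq_right h]; ring

lemma red_mut_self {m : ℕ} {B : Matrix (Fin 3) (Fin 3) ℤ} {C : Matrix (Fin 3) (Fin m) ℤ}
    {k : Fin 3} (h : QGreen C k) : QRed (mutC B C k) k := by
  have : mutC B C k k = -(C k) := funext fun t => mutC_self B C k t
  refine ⟨fun t => ?_, ?_⟩
  · have := h.1 t
    rw [mutC_self]; omega
  · rw [this]; simpa using h.2

lemma green_mut_self {m : ℕ} {B : Matrix (Fin 3) (Fin 3) ℤ} {C : Matrix (Fin 3) (Fin m) ℤ}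
    {k : Fin 3} (h : QRed C k) : QGreen (mutC B C k) k := by
  have : mutC B C k k = -(C k) := funext fun t => mutC_self B C k t
  refine ⟨fun t => ?_, ?_⟩
  · have := h.1 t
    rw [mutC_self]; omega
  · rw [this]; simpa using h.2

lemma step_one {m : ℕ} {B : Matrix (Fin 3) (Fin 3) ℤ} {C : Matrix (Fin 3) (Fin m) ℤ}
    {r k : Fin 3} (hs : ∀ i j, B j i = -B i j) (hB : CycThree B)
    (hm : ∀ k, CycThree (mutB B k)) (hk : k ≠ r) (h : GoodOne B C r) :
    GoodInv (mutB B k) (mutC B C k) k := by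
  obtain ⟨i, j, h1, h2, h3, bri, bij, bjr, hr, hi, hj⟩ := h
  have gi := green_of_dom hr hi
  have w1 := two_le B hs hB hm r i j h1 h2 h3 bri
  have w2 := two_le B hs hB hm i j r h2 h3 h1 bij
  have w3 := two_le B hs hB hm j r i h3 h1 h2 bjr
  have s1 := hs r i
  have s2 := hs i j
  have s3 := hs j r
  have hc := hm k r i j h1 h2 h3
  have sk := mutB_skew B hs k
  have t1 := sk r i
  have t2 := sk i j
  have t3 := sk j r
  rcases third_vertex r i j h1 h2 h3 k with rfl | rfl | rfl
  · exact absurd rfl hk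
  · left
    rw [mutB_left, mutB_right] at hc
    refine ⟨r, j, h1.symm, h3.symm, h2.symm, ?_, by omega, ?_, red_mut_self gi, ?_, ?_⟩
    · rw [mutB_left]; omega
    · rw [mutB_right]; omega
    · intro t
      rw [mutC_self, mutC_pos B C k r t h1 bri (gi.1 t)]
      nlinarith [gi.1 t, hi t]
    · have e : mutC B C k j = C j := funext fun t =>
        mutC_same B C k j t h2.symm (mul_nonpos_of_nonpos_of_nonneg (by omega) (gi.1 t))
      simpa only [QRed, QGreen, e] using hj
  · rw [mutB_left, mutB_right] at hc
    rcases hj with hj | hj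
    · right
      rw [← mutB_neg, ← mutC_neg]
      rw [mutB_neg, mutC_neg]
      refine ⟨r, i, h3, h1, h2, ?_, ?_, ?_, (red_neg _ _).2 (green_mut_self hj), ?_, ?_⟩
      · rw [Matrix.neg_apply, mutB_left]; omega
      · rw [Matrix.neg_apply]; omega
      · rw [Matrix.neg_apply, mutB_right]; omega
      · intro t
        rw [Matrix.neg_apply, Matrix.neg_apply, mutC_self,
          mutC_neg_neg B C k r t h3.symm (by omega) (hj.1 t)]
        nlinarith [hj.1 t, hr.1 t]
      · rw [red_neg, green_neg]
        have e : mutC B C k i = C i := funext fun t =>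
          mutC_same B C k i t h2 (mul_nonpos_of_nonneg_of_nonpos bij.le (hj.1 t))
        left
        simpa only [QGreen, e] using gi
    · left
      refine ⟨i, r, h2.symm, h1.symm, h3.symm, ?_, by omega, ?_, red_mut_self hj, ?_, ?_⟩
      · rw [mutB_left]; omega
      · rw [mutB_right]; omega
      · intro t
        rw [mutC_self, mutC_pos B C k i t h2 bij (hj.1 t)]
        nlinarith [hj.1 t, gi.1 t]
      · have e : mutC B C k r = C r := funext fun t =>
          mutC_same B C k r t h3.symm
            (mul_nonpos_of_nonpos_of_nonneg (by omega) (hj.1 t))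
        left
        simpa only [QRed, e] using hr

lemma step_good {m : ℕ} {B : Matrix (Fin 3) (Fin 3) ℤ} {C : Matrix (Fin 3) (Fin m) ℤ}
    {r k : Fin 3} (hs : ∀ i j, B j i = -B i j) (hB : CycThree B)
    (hm : ∀ k, CycThree (mutB B k)) (hk : k ≠ r) (h : GoodInv B C r) :
    GoodInv (mutB B k) (mutC B C k) k := by
  rcases h with h | h
  · exact step_one hs hB hm hk h
  · have := step_one (fun i j => by simp [hs i j]) hB.neg
      (fun k => by rw [mutB_neg]; exact (hm k).neg) hk h
    rw [mutB_neg, mutC_neg] at this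
    rcases this with h | h
    · exact Or.inr h
    · left
      simpa using h

lemma good_seq {m : ℕ} (u : List (Fin 3)) :
    ∀ (P : Matrix (Fin 3) (Fin 3) ℤ × Matrix (Fin 3) (Fin m) ℤ) (r : Fin 3),
      (∀ i j, P.1 j i = -P.1 i j) → (∀ w : List (Fin 3), ¬ QAcyclic (mutSeqB P.1 w)) →
      GoodInv P.1 P.2 r → List.IsChain (· ≠ ·) (r :: u) →
      FourConds (mutSeqPair P u).1 (mutSeqPair P u).2
        ((r :: u).getLast (List.cons_ne_nil r u)) := by
  induction u with
  | nil => intro P r hs hc hg _; exact four_of_good hs hg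
  | cons k u ih =>
    intro P r hs hc hg hch
    rw [List.isChain_cons_cons] at hch
    rw [List.getLast_cons_cons]
    refine ih (mutPair P k) k (mutB_skew P.1 hs k) (fun w => hc (k :: w)) ?_ hch.2
    exact step_good hs (cyc_of_not_acyclic _ hs (hc []))
      (fun k => cyc_of_not_acyclic _ (mutB_skew P.1 hs k) (hc [k])) hch.1.symm hg

/-- Lemma `lem-control-signs-3-cyclic`. -/
theorem control_signs_three_cyclic {m : ℕ}
    (B : Matrix (Fin 3) (Fin 3) ℤ) (C : Matrix (Fin 3) (Fin m) ℤ)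
    (hskew : ∀ i j, B j i = -B i j)
    (hcyc : ∀ w : List (Fin 3), ¬ QAcyclic (mutSeqB B w))
    (v : Fin 3)
    (hbase : FourConds (mutPair (B, C) v).1 (mutPair (B, C) v).2 v)
    (w : List (Fin 3)) (hw : w ≠ []) (hhead : w.head hw = v)
    (hreduced : List.Chain' (· ≠ ·) w) :
    FourConds (mutSeqPair (B, C) w).1 (mutSeqPair (B, C) w).2 (w.getLast hw) := by
  cases w with
  | nil => exact absurd rfl hw
  | cons k u =>
    simp only [List.head_cons] at hhead
    subst hhead
    have hsk := mutB_skew B hskew k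
    exact good_seq u (mutPair (B, C) k) k hsk (fun w => hcyc (k :: w))
      (good_of_four hsk (cyc_of_not_acyclic _ hsk (hcyc [k])) hbase) hreduced
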